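/- Let P = ⟨H,M,T⟩ be an abduction problem with H = {h₁,…,hₙ}, and let C = {c₁,…,cₙ}, D = {d₁,…,dₙ}, E = {e₁,…,eₙ} be sets of fresh propositional variables in one-to-one correspondence with H. Define P' = ⟨H',M',T'⟩ by H' = C ∪ D, M' = M ∪ E, and T' = { cᵢ → hᵢ, cᵢ → eᵢ, dᵢ → eᵢ : 1 ≤ i ≤ n } ∪ T. Then every solution H₂ ∈ SOL(P') contains, for each index i, at least one of cᵢ and dᵢ. -/

import Mathlib

/-- Propositional formulas over a set `V` of variables. -/
inductive PropForm (V : Type) : Type where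
  | fls  : PropForm V
  | var  : V → PropForm V
  | neg  : PropForm V → PropForm V
  | conj : PropForm V → PropForm V → PropForm V
  | disj : PropForm V → PropForm V → PropForm V
  | imp  : PropForm V → PropForm V → PropForm V
  deriving DecidableEq

namespace PropForm

/-- Truth of a formula under a valuation. -/
def eval {V : Type} (v : V → Prop) : PropForm V → Prop
  | fls => False
  | var x => v x
  | neg φ => ¬ eval v φ
  | conj φ ψ => eval v φ ∧ eval v ψ
  | disj φ ψ => eval v φ ∨ eval v ψ
  | imp φ ψ => eval v φ → eval v ψ

/-- The set of variables occurring in a formula. -/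
def vars {V : Type} : PropForm V → Set V
  | fls => ∅
  | var x => {x}
  | neg φ => vars φ
  | conj φ ψ => vars φ ∪ vars ψ
  | disj φ ψ => vars φ ∪ vars ψ
  | imp φ ψ => vars φ ∪ vars ψ

end PropForm

/-- An abduction problem `⟨H, M, T⟩`: hypotheses, manifestations, theory. -/
structure AbdProblem (V : Type) [DecidableEq V] : Type where
  H : Finset V
  M : Finset V
  T : Finset (PropForm V)

variable {V : Type} [DecidableEq V]

/-- `v` is a model of the hypotheses `A` together with the theory `T`. -/
def models (v : V → Prop) (A : Finset V) (T : Finset (PropForm V)) : Prop :=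
  (∀ x ∈ A, v x) ∧ (∀ φ ∈ T, φ.eval v)

/-- `A` is a solution of `P`: `A ⊆ H`, `A ∪ T` is satisfiable, `A ∪ T ⊨ m` for `m ∈ M`. -/
def isSol (P : AbdProblem V) (A : Finset V) : Prop :=
  A ⊆ P.H ∧ (∃ v, models v A P.T) ∧ ∀ v, models v A P.T → ∀ m ∈ P.M, v m

/-- The set of solutions of `P`. -/
def SOL (P : AbdProblem V) : Set (Finset V) := {A | isSol P A}

/-- The solutions of `P` minimal under set inclusion. -/
def SOLsub (P : AbdProblem V) : Set (Finset V) :=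
  {A | A ∈ SOL P ∧ ∀ B ∈ SOL P, B ⊆ A → B = A}

/-- The solutions of `P` of minimum cardinality. -/
def SOLcard (P : AbdProblem V) : Set (Finset V) :=
  {A | A ∈ SOL P ∧ ∀ B ∈ SOL P, A.card ≤ B.card}

/-- `x` is fresh for `P`: it occurs neither in `H`, nor in `M`, nor in any formula of `T`. -/
def freshFor (P : AbdProblem V) (x : V) : Prop :=
  x ∉ P.H ∧ x ∉ P.M ∧ ∀ φ ∈ P.T, x ∉ φ.vars

/-- The problem `P' = ⟨C ∪ D, M ∪ E, {cᵢ → hᵢ, cᵢ → eᵢ, dᵢ → eᵢ : i} ∪ T⟩`. -/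
def splitProb (P : AbdProblem V) {n : ℕ} (h c d e : Fin n → V) : AbdProblem V where
  H := Finset.univ.image c ∪ Finset.univ.image d
  M := P.M ∪ Finset.univ.image e
  T := Finset.univ.image (fun i => PropForm.imp (PropForm.var (c i)) (PropForm.var (h i)))
    ∪ Finset.univ.image (fun i => PropForm.imp (PropForm.var (c i)) (PropForm.var (e i)))
    ∪ Finset.univ.image (fun i => PropForm.imp (PropForm.var (d i)) (PropForm.var (e i)))
    ∪ P.T

/-- The value of a formula depends only on the values of the variables occurring in it. -/
theorem PropForm.eval_congr {V : Type} {v w : V → Prop} {φ : PropForm V}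
    (hvw : ∀ x ∈ φ.vars, v x ↔ w x) : φ.eval v ↔ φ.eval w := by
  induction φ with
  | fls => exact Iff.rfl
  | var x => exact hvw x rfl
  | neg φ ih => exact not_congr (ih hvw)
  | conj φ ψ ihφ ihψ =>
    exact and_congr (ihφ fun x hx => hvw x (Or.inl hx)) (ihψ fun x hx => hvw x (Or.inr hx))
  | disj φ ψ ihφ ihψ =>
    exact or_congr (ihφ fun x hx => hvw x (Or.inl hx)) (ihψ fun x hx => hvw x (Or.inr hx))
  | imp φ ψ ihφ ihψ =>
    exact imp_congr (ihφ fun x hx => hvw x (Or.inl hx)) (ihψ fun x hx => hvw x (Or.inr hx))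

/-- The models of the split problem, spelled out. -/
theorem models_splitProb_iff {P : AbdProblem V} {n : ℕ} {h c d e : Fin n → V}
    {v : V → Prop} {A : Finset V} :
    models v A (splitProb P h c d e).T ↔
      (∀ x ∈ A, v x) ∧ (∀ j, v (c j) → v (h j)) ∧ (∀ j, v (c j) → v (e j)) ∧
        (∀ j, v (d j) → v (e j)) ∧ ∀ φ ∈ P.T, φ.eval v := by
  simp only [models, splitProb, Finset.mem_union, or_imp, forall_and, Finset.mem_image,
    Finset.mem_univ, true_and, forall_exists_index, forall_apply_eq_imp_iff, PropForm.eval,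
    and_assoc]

theorem split_solution_covers (P : AbdProblem V) (n : ℕ) (h c d e : Fin n → V)
    (hH : P.H = Finset.univ.image h)
    (hinj : Function.Injective h) (cinj : Function.Injective c)
    (dinj : Function.Injective d) (einj : Function.Injective e)
    (cfresh : ∀ i, freshFor P (c i)) (dfresh : ∀ i, freshFor P (d i))
    (efresh : ∀ i, freshFor P (e i))
    (cd : ∀ i j, c i ≠ d j) (ce : ∀ i j, c i ≠ e j) (de : ∀ i j, d i ≠ e j)
    (H₂ : Finset V) (hH₂ : H₂ ∈ SOL (splitProb P h c d e)) :
    ∀ i, c i ∈ H₂ ∨ d i ∈ H₂ := by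
  obtain ⟨hsub, ⟨v, hv⟩, hent⟩ := hH₂
  intro i
  by_contra! hi
  obtain ⟨hci, hdi⟩ := hi
  obtain ⟨hA, hch, hce, hde, hT⟩ := models_splitProb_iff.1 hv
  have hne {x y : V} (hx : x ∈ P.H) (hy : freshFor P y) : x ≠ y := fun hxy => hy.1 (hxy ▸ hx)
  have hmem (j : Fin n) : h j ∈ P.H := hH ▸ Finset.mem_image_of_mem h (Finset.mem_univ j)
  -- Falsifying `c i`, `d i` and `e i` in a model of `H₂` gives another model of `H₂`.
  let w : V → Prop := fun x => v x ∧ x ≠ c i ∧ x ≠ d i ∧ x ≠ e i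
  have hw : models w H₂ (splitProb P h c d e).T := by
    refine models_splitProb_iff.2 ⟨fun x hx => ?_, fun j hj => ?_, fun j hj => ?_,
      fun j hj => ?_, fun φ hφ => ?_⟩
    · refine ⟨hA x hx, ne_of_mem_of_not_mem hx hci, ne_of_mem_of_not_mem hx hdi, ?_⟩
      have hx' := hsub hx
      simp only [splitProb, Finset.mem_union, Finset.mem_image, Finset.mem_univ,
        true_and] at hx'
      rcases hx' with ⟨j, rfl⟩ | ⟨j, rfl⟩
      · exact ce j i
      · exact de j i
    · exact ⟨hch j hj.1, hne (hmem j) (cfresh i), hne (hmem j) (dfresh i),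
        hne (hmem j) (efresh i)⟩
    · exact ⟨hce j hj.1, (ce i j).symm, (de i j).symm,
        einj.ne fun hji => hj.2.1 (congrArg c hji)⟩
    · exact ⟨hde j hj.1, (ce i j).symm, (de i j).symm,
        einj.ne fun hji => hj.2.2.1 (congrArg d hji)⟩
    · refine (PropForm.eval_congr fun x hx => ?_).1 (hT φ hφ)
      have hxne {y : V} (hy : freshFor P y) : x ≠ y := fun hxy => hy.2.2 φ hφ (hxy ▸ hx)
      exact (and_iff_left ⟨hxne (cfresh i), hxne (dfresh i), hxne (efresh i)⟩).symm
  have hei : e i ∈ (splitProb P h c d e).M :=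
    Finset.mem_union_right _ (Finset.mem_image_of_mem e (Finset.mem_univ i))
  exact (hent w hw (e i) hei).2.2.2 rfl
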